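/- There exist a constant c > 0 and N such that for every even n ≥ N, every nondeterministic finite automaton A over the alphabet Σ_n whose language L(A) has Parikh image equal to the universal one-counter set U_n has at least n^{c·√(log n / log log n)} states. -/

import Mathlib

/-- The alphabet Σₙ = {c i j} ∪ {a i} (the letters `c i j` are only meaningful
for i < j; Parikh vectors in the universal one-counter set force the count of
any letter `c i j` with i ≥ j to be zero). -/
inductive Alph (n : ℕ) where
  | c (i j : Fin n) : Alph n
  | a (i : Fin n) : Alph n
deriving DecidableEq

/-- The graph with edge relation `y` is a monotone path (chain) from 0 to n−1:
its edges are exactly the consecutive pairs of a strictly increasing sequence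
of vertices starting at 0 and ending at n−1. -/
def IsChainGraph (n : ℕ) (y : Fin n → Fin n → Prop) : Prop :=
  ∃ (k : ℕ) (v : Fin (k + 1) → Fin n),
    StrictMono v ∧ (v 0 : ℕ) = 0 ∧ (v (Fin.last k) : ℕ) = n - 1 ∧
    ∀ i j : Fin n, y i j ↔ ∃ t : Fin k, v t.castSucc = i ∧ v t.succ = j

/-- The universal one-counter set Uₙ, as a set of Parikh vectors over Σₙ:
writing y i j = f (c i j) and x i = f (a i), we require (U1) the y's are 0/1
and form a chain from 0 to n−1, (U3) the x's are balanced, and (U4) the x's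
are compatible with the chain. -/
def UniversalOCA (n : ℕ) : Set (Alph n → ℕ) :=
  { f |
    (∀ i j : Fin n, ¬ i < j → f (.c i j) = 0) ∧
    (∀ i j : Fin n, f (.c i j) ≤ 1) ∧
    IsChainGraph n (fun i j => f (.c i j) = 1) ∧
    (∑ i : Fin n, (-1 : ℤ) ^ (i : ℕ) * (f (.a i) : ℤ) = 0) ∧
    (∀ k : ℕ, k < n - 1 →
      0 ≤ ∑ i ∈ Finset.univ.filter (fun i : Fin n => (i : ℕ) ≤ k),
        (-1 : ℤ) ^ (i : ℕ) * (f (.a i) : ℤ)) ∧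
    (∀ j : Fin n, 0 < f (.a j) →
      ((0 < (j : ℕ) → ∃ i, f (.c i j) = 1) ∧
       ((j : ℕ) < n - 1 → ∃ k, f (.c j k) = 1))) }

/-- Parikh image of the language accepted by an NFA. -/
def ParikhImage {α : Type*} [DecidableEq α] {σ : Type*} (M : NFA α σ) :
    Set (α → ℕ) :=
  { g | ∃ w ∈ M.accepts, ∀ l : α, g l = w.count l }

/-- The length of a block of level `j` of the hard sequence with parameters `a` and `b`. -/
def blockLength (a b : ℕ) : ℕ → ℕ
  | 0 => 1
  | j + 1 => a * blockLength a b j + b * a ^ j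

/-- The labels of a block: a block of level `0` is a single position labelled `0` (an ascent), a
block of level `j + 1` is made of `a` blocks of level `j` and a run of `b * a ^ j` positions
labelled `j + 1` (descents). -/
def blockLabel (a b : ℕ) : ℕ → ℕ → ℕ
  | 0, _ => 0
  | j + 1, p =>
    if p < a * blockLength a b j then blockLabel a b j (p % blockLength a b j) else j + 1

/-- The labelling `lab` has a block of level `j` at offset `o`. -/
def IsBlock (a b : ℕ) (lab : ℕ → ℕ) : ℕ → ℕ → Prop
  | 0, o => lab o = 0
  | j + 1, o => (∀ i < a, IsBlock a b lab j (o + i * blockLength a b j)) ∧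
      ∀ i < b * a ^ j, lab (o + a * blockLength a b j + i) = j + 1

/-- Positions labelled `0` count as ascents, all others as descents. -/
def stepSign (l : ℕ) : ℤ := if l = 0 then 1 else -1

theorem sum_range_mul_add {M : Type*} [AddCommMonoid M] (f : ℕ → M) (o a L : ℕ) :
    ∑ r ∈ Finset.range (a * L), f (o + r) =
      ∑ i ∈ Finset.range a, ∑ r ∈ Finset.range L, f (o + i * L + r) := by
  induction a with
  | zero => simp
  | succ a ih =>
    rw [Finset.sum_range_succ, ← ih, Nat.succ_mul, Finset.sum_range_add]
    simp only [add_assoc]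

theorem sum_blockLength_succ {M : Type*} [AddCommMonoid M] (f : ℕ → M) (a b o j : ℕ) :
    ∑ r ∈ Finset.range (blockLength a b (j + 1)), f (o + r) =
      ∑ i ∈ Finset.range a, ∑ r ∈ Finset.range (blockLength a b j),
          f (o + i * blockLength a b j + r) +
        ∑ i ∈ Finset.range (b * a ^ j), f (o + a * blockLength a b j + i) := by
  rw [← sum_range_mul_add, blockLength, Finset.sum_range_add]
  simp only [add_assoc]

theorem isBlock_of_eq_blockLabel (a b : ℕ) (lab : ℕ → ℕ) (j o : ℕ)
    (h : ∀ r < blockLength a b j, lab (o + r) = blockLabel a b j r) : IsBlock a b lab j o := by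
  induction j generalizing o with
  | zero => simpa [IsBlock, blockLabel] using h 0 (by simp [blockLength])
  | succ j ih =>
    refine ⟨fun i hi => ih _ fun r hr => ?_, fun i hi => ?_⟩
    · have hlt : i * blockLength a b j + r < a * blockLength a b j :=
        calc i * blockLength a b j + r < (i + 1) * blockLength a b j := by rw [Nat.succ_mul]; omega
          _ ≤ a * blockLength a b j := Nat.mul_le_mul_right _ hi
      rw [add_assoc, h _ (by rw [blockLength]; omega), blockLabel, if_pos hlt, add_comm,
        Nat.add_mul_mod_self_right, Nat.mod_eq_of_lt hr]
    · rw [add_assoc, h _ (by rw [blockLength]; omega), blockLabel, if_neg (by omega)]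

theorem isBlock_blockLabel (a b j : ℕ) :
    IsBlock a b (blockLabel a b j) j 0 :=
  isBlock_of_eq_blockLabel a b _ j 0 fun r _ => by rw [zero_add]

theorem IsBlock.label_le {a b : ℕ} {lab : ℕ → ℕ} {j o : ℕ} (h : IsBlock a b lab j o) :
    ∀ r < blockLength a b j, lab (o + r) ≤ j := by
  induction j generalizing o with
  | zero =>
    intro r hr
    simp only [blockLength, Nat.lt_one_iff] at hr
    simp [hr, show lab o = 0 from h]
  | succ j ih =>
    intro r hr
    rw [blockLength] at hr
    by_cases hr' : r < a * blockLength a b j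
    · have hL : 0 < blockLength a b j := by
        rcases Nat.eq_zero_or_pos (blockLength a b j) with h0 | h0
        · simp [h0] at hr'
        · exact h0
      have := ih (h.1 (r / blockLength a b j) (by
        rw [Nat.div_lt_iff_lt_mul hL]; exact hr')) (r % blockLength a b j) (Nat.mod_lt _ hL)
      rw [add_assoc, Nat.div_add_mod'] at this
      omega
    · have := h.2 (r - a * blockLength a b j) (by omega)
      rw [add_assoc, Nat.add_sub_cancel' (by omega)] at this
      omega

theorem IsBlock.sum_ascents {a b : ℕ} {lab : ℕ → ℕ} {j o : ℕ} (h : IsBlock a b lab j o) :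
    ∑ r ∈ Finset.range (blockLength a b j), (if lab (o + r) = 0 then (1 : ℤ) else 0) =
      (a : ℤ) ^ j := by
  induction j generalizing o with
  | zero =>
    have h0 : lab o = 0 := h
    simp only [blockLength, Finset.sum_range_one, add_zero, h0, if_true, pow_zero]
  | succ j ih =>
    have hrun : ∑ i ∈ Finset.range (b * a ^ j),
        (if lab (o + a * blockLength a b j + i) = 0 then (1 : ℤ) else 0) = 0 :=
      Finset.sum_eq_zero fun i hi => by simp [h.2 i (Finset.mem_range.1 hi)]
    rw [sum_blockLength_succ (fun p => if lab p = 0 then (1 : ℤ) else 0),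
      Finset.sum_congr rfl fun i hi => ih (h.1 i (Finset.mem_range.1 hi)), hrun]
    simp [pow_succ']

/-- A bound on sums over level `j` blocks and over single positions with label above `j` gives a
bound on sums over all higher blocks. -/
theorem IsBlock.sum_le_sum {a b : ℕ} {lab : ℕ → ℕ} {j K : ℕ} {F G : ℕ → ℤ}
    (hblock : ∀ o, IsBlock a b lab j o → o + blockLength a b j ≤ K →
      ∑ r ∈ Finset.range (blockLength a b j), F (o + r) ≤
        ∑ r ∈ Finset.range (blockLength a b j), G (o + r))
    (hrun : ∀ p, j < lab p → F p ≤ G p) {i o : ℕ} (hji : j ≤ i) (h : IsBlock a b lab i o)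
    (hK : o + blockLength a b i ≤ K) :
    ∑ r ∈ Finset.range (blockLength a b i), F (o + r) ≤
      ∑ r ∈ Finset.range (blockLength a b i), G (o + r) := by
  induction i, hji using Nat.le_induction generalizing o with
  | base => exact hblock o h hK
  | succ i hji ih =>
    rw [sum_blockLength_succ F, sum_blockLength_succ G]
    refine add_le_add (Finset.sum_le_sum fun t ht => ih (h.1 t (Finset.mem_range.1 ht)) ?_)
      (Finset.sum_le_sum fun t ht => hrun _ ?_)
    · have : (t + 1) * blockLength a b i ≤ a * blockLength a b i :=
        Nat.mul_le_mul_right _ (Finset.mem_range.1 ht)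
      rw [Nat.succ_mul] at this
      rw [blockLength] at hK
      omega
    · rw [h.2 t (Finset.mem_range.1 ht)]
      omega

/-- For `a = b * w`, a block of level `j ≤ w` has total height `(1 - j / w) * a ^ j`. -/
theorem IsBlock.sum_stepSign {b w : ℕ} {lab : ℕ → ℕ} {j o : ℕ} (h : IsBlock (b * w) b lab j o) :
    (w : ℤ) * ∑ r ∈ Finset.range (blockLength (b * w) b j), stepSign (lab (o + r)) =
      ((w : ℤ) - j) * ((b * w : ℕ) : ℤ) ^ j := by
  induction j generalizing o with
  | zero => simp [blockLength, show lab o = 0 from h, stepSign]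
  | succ j ih =>
    have hrun : ∑ i ∈ Finset.range (b * (b * w) ^ j),
        stepSign (lab (o + b * w * blockLength (b * w) b j + i)) = -(b * (b * w) ^ j) := by
      rw [Finset.sum_congr rfl fun i hi => by rw [h.2 i (Finset.mem_range.1 hi)]]
      simp [stepSign]
    rw [sum_blockLength_succ (fun p => stepSign (lab p)), mul_add, Finset.mul_sum,
      Finset.sum_congr rfl fun i hi => ih (h.1 i (Finset.mem_range.1 hi)), hrun]
    simp only [Finset.sum_const, Finset.card_range, nsmul_eq_mul]
    push_cast
    ring

theorem mul_blockLength (b w j : ℕ) :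
    w * blockLength (b * w) b j = (w + j) * (b * w) ^ j := by
  induction j with
  | zero => simp [blockLength]
  | succ j ih =>
    rw [blockLength, mul_add, mul_left_comm, ih]
    ring

theorem blockLength_self {b w : ℕ} (hw : 0 < w) :
    blockLength (b * w) b w = 2 * (b * w) ^ w := by
  have := mul_blockLength b w w
  rw [← two_mul, mul_comm 2 w, mul_assoc] at this
  exact Nat.eq_of_mul_eq_mul_left hw this

theorem IsBlock.sum_stepSign_nonneg {b w : ℕ} (hw : 0 < w) {lab : ℕ → ℕ} {j o : ℕ} (hj : j ≤ w)
    (h : IsBlock (b * w) b lab j o) :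
    0 ≤ ∑ r ∈ Finset.range (blockLength (b * w) b j), stepSign (lab (o + r)) := by
  have := h.sum_stepSign
  have h2 : (0 : ℤ) ≤ ((w : ℤ) - j) * ((b * w : ℕ) : ℤ) ^ j :=
    mul_nonneg (by omega) (by positivity)
  rw [← this] at h2
  exact nonneg_of_mul_nonneg_right h2 (by exact_mod_cast hw)

theorem IsBlock.sum_range_nonneg_of_le {b w : ℕ} (hw : 0 < w) {lab : ℕ → ℕ} {j o : ℕ} (hj : j ≤ w)
    (h : IsBlock (b * w) b lab j o) {q : ℕ} (hq : q ≤ blockLength (b * w) b j) :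
    0 ≤ ∑ r ∈ Finset.range q, stepSign (lab (o + r)) := by
  induction j generalizing o q with
  | zero =>
    refine Finset.sum_nonneg fun r hr => ?_
    simp only [blockLength] at hq
    have hr0 : r = 0 := by have := Finset.mem_range.1 hr; omega
    simp [hr0, show lab o = 0 from h, stepSign]
  | succ j ih =>
    set L := blockLength (b * w) b j with hL
    by_cases hq' : q < b * w * L
    · have hL0 : 0 < L := by
        rcases Nat.eq_zero_or_pos L with h0 | h0
        · simp [h0] at hq'
        · exact h0
      have hdiv : q / L < b * w := by rwa [Nat.div_lt_iff_lt_mul hL0]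
      rw [← Nat.div_add_mod' q L, Finset.sum_range_add,
        sum_range_mul_add (fun p => stepSign (lab p))]
      refine add_nonneg (Finset.sum_nonneg fun i hi => ?_) ?_
      · exact (h.1 i ((Finset.mem_range.1 hi).trans hdiv)).sum_stepSign_nonneg hw (by omega)
      · simp only [← add_assoc]
        exact ih (by omega) (h.1 _ hdiv) (Nat.mod_lt _ hL0).le
    · have htot := h.sum_stepSign_nonneg hw hj
      have hsplit : blockLength (b * w) b (j + 1) = q + (blockLength (b * w) b (j + 1) - q) := by
        omega
      rw [hsplit, Finset.sum_range_add] at htot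
      have htail : ∑ x ∈ Finset.range (blockLength (b * w) b (j + 1) - q),
          stepSign (lab (o + (q + x))) ≤ 0 := by
        refine Finset.sum_nonpos fun x hx => ?_
        have hx := Finset.mem_range.1 hx
        rw [blockLength, ← hL] at hx
        have := h.2 (q + x - b * w * L) (by omega)
        rw [← hL, add_assoc, Nat.add_sub_cancel' (by omega)] at this
        simp [this, stepSign]
      omega

/-- A sweep of the positions below `K`: at each time `t` every position is unread (`c t p = 0`),
partially read (`c t p = 1`) or fully read (`c t p = 2`). Fully read and unread positions are
never adjacent, at most `w` positions are partially read, and the signed count of the fully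
read positions is always close to zero. -/
structure IsSweep (lab : ℕ → ℕ) (K w : ℕ) (c : ℕ → ℕ → ℕ) : Prop where
  le_two : ∀ t p, c t p ≤ 2
  mono : ∀ p, Monotone fun t => c t p
  step : ∀ t p, p < K → c t p = 0 → c (t + 1) p ≠ 2
  adj_zero : ∀ t p, p + 1 < K → c t p = 0 → c t (p + 1) ≠ 2
  adj_two : ∀ t p, p + 1 < K → c t p = 2 → c t (p + 1) ≠ 0
  few : ∀ t, ((Finset.range K).filter fun p => c t p = 1).card ≤ w
  net : ∀ t, |∑ p ∈ Finset.range K, if c t p = 2 then stepSign (lab p) else 0| ≤ w + 1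

namespace IsSweep

variable {lab : ℕ → ℕ} {K w : ℕ} {c : ℕ → ℕ → ℕ}

theorem eq_of_ne_one (hs : IsSweep lab K w c) {t o m : ℕ} (hK : o + m ≤ K)
    (h : ∀ r < m, c t (o + r) ≠ 1) : ∀ r < m, c t (o + r) = c t o := by
  intro r
  induction r with
  | zero => simp
  | succ r ih =>
    intro hr
    have h1 := ih (by omega)
    have h2 := h r (by omega)
    have h3 := h (r + 1) hr
    have h4 := hs.adj_zero t (o + r) (by omega)
    have h5 := hs.adj_two t (o + r) (by omega)
    have h6 := hs.le_two t (o + r)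
    have h7 := hs.le_two t (o + r + 1)
    rw [← add_assoc] at h3 ⊢
    omega

theorem exists_eq_one (hs : IsSweep lab K w c) {t o m : ℕ} (hK : o + m ≤ K)
    (h0 : ¬ ∀ r < m, c t (o + r) = 0) (h2 : ¬ ∀ r < m, c t (o + r) = 2) :
    ∃ r < m, c t (o + r) = 1 := by
  by_contra! hne
  have heq := hs.eq_of_ne_one hK hne
  have hle := hs.le_two t o
  push Not at h0 h2
  obtain ⟨r, hr, hr0⟩ := h0
  obtain ⟨q, hq, hq2⟩ := h2
  have := heq r hr
  have := heq q hq
  have := hne r hr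
  omega

/-- A run that is unread at time `t₁` and fully read at time `t₂` is, throughout some interval of
times, in an intermediate state that includes a partially read position. -/
theorem exists_interval (hs : IsSweep lab K w c) {t₁ t₂ o m : ℕ} (hm : 0 < m) (hK : o + m ≤ K)
    (h0 : ∀ r < m, c t₁ (o + r) = 0) (h2 : ∀ r < m, c t₂ (o + r) = 2) :
    ∃ s₁ s₂, t₁ ≤ s₁ ∧ s₂ ≤ t₂ ∧ (∀ r < m, c s₁ (o + r) = 0) ∧ (∀ r < m, c s₂ (o + r) = 2) ∧
      ∀ t, s₁ < t → t < s₂ → ∃ r < m, c t (o + r) = 1 := by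
  classical
  have hex : ∃ t, ∀ r < m, c t (o + r) = 2 := ⟨t₂, h2⟩
  have hlt : t₁ ≤ Nat.find hex := by
    by_contra! hlt
    have h3 := Nat.find_spec hex 0 hm
    have h4 := h0 0 hm
    have h5 : c (Nat.find hex) (o + 0) ≤ c t₁ (o + 0) := hs.mono (o + 0) hlt.le
    omega
  refine ⟨Nat.findGreatest (fun t => ∀ r < m, c t (o + r) = 0) (Nat.find hex), Nat.find hex,
    Nat.le_findGreatest hlt h0, Nat.find_min' hex h2, ?_, Nat.find_spec hex, fun t ht₁ ht₂ => ?_⟩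
  · exact Nat.findGreatest_spec (P := fun t => ∀ r < m, c t (o + r) = 0) hlt h0
  · exact hs.exists_eq_one hK (Nat.findGreatest_is_greatest ht₁ ht₂.le) (Nat.find_min hex ht₂)

/-- If no level `j` block gets entirely read between times `s₁` and `s₂`, then the partially read
positions bound the change of the signed count of fully read positions within each block. -/
theorem block_change_le (hs : IsSweep lab K w c) {a b j o s₁ s₂ : ℕ} (hs₁₂ : s₁ ≤ s₂)
    (h : IsBlock a b lab j o) (hK : o + blockLength a b j ≤ K)
    (hnot : ¬ ((∀ r < blockLength a b j, c s₁ (o + r) = 0) ∧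
      ∀ r < blockLength a b j, c s₂ (o + r) = 2)) :
    ∑ r ∈ Finset.range (blockLength a b j),
        ((if c s₂ (o + r) = 2 then stepSign (lab (o + r)) else 0) -
          if c s₁ (o + r) = 2 then stepSign (lab (o + r)) else 0) ≤
      ∑ r ∈ Finset.range (blockLength a b j),
        (a : ℤ) ^ j * ((if c s₁ (o + r) = 1 then 1 else 0) +
          if c s₂ (o + r) = 1 then 1 else 0) := by
  have hmono : ∀ p, c s₁ p ≤ c s₂ p := fun p => hs.mono p hs₁₂
  have hnonneg : ∀ r ∈ Finset.range (blockLength a b j),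
      (0 : ℤ) ≤ (a : ℤ) ^ j * ((if c s₁ (o + r) = 1 then 1 else 0) +
        if c s₂ (o + r) = 1 then 1 else 0) := fun r _ => by
    refine mul_nonneg (by positivity) ?_
    split_ifs <;> norm_num
  by_cases hmix : ∃ r < blockLength a b j, c s₁ (o + r) = 1 ∨ c s₂ (o + r) = 1
  · obtain ⟨r, hr, hr1⟩ := hmix
    calc _ ≤ ∑ r ∈ Finset.range (blockLength a b j),
          (if lab (o + r) = 0 then (1 : ℤ) else 0) := by
          refine Finset.sum_le_sum fun r _ => ?_
          have := hmono (o + r)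
          have := hs.le_two s₂ (o + r)
          unfold stepSign
          split_ifs <;> omega
      _ = (a : ℤ) ^ j * 1 := by rw [h.sum_ascents, mul_one]
      _ ≤ (a : ℤ) ^ j * ((if c s₁ (o + r) = 1 then 1 else 0) +
            if c s₂ (o + r) = 1 then 1 else 0) := by
          refine mul_le_mul_of_nonneg_left ?_ (by positivity)
          split_ifs <;> omega
      _ ≤ _ := Finset.single_le_sum hnonneg (Finset.mem_range.2 hr)
  · push Not at hmix
    have h1 := hs.eq_of_ne_one hK fun r hr => (hmix r hr).1
    have h2 := hs.eq_of_ne_one hK fun r hr => (hmix r hr).2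
    refine (Finset.sum_nonpos fun r hr => ?_).trans (Finset.sum_nonneg hnonneg)
    have hr := Finset.mem_range.1 hr
    have h3 := hmix r hr
    have h4 := hmono (o + r)
    have h5 := hs.le_two s₁ (o + r)
    have h6 := hs.le_two s₂ (o + r)
    have h7 := h1 r hr
    have h8 := h2 r hr
    have h9 : ¬ (c s₁ o = 0 ∧ c s₂ o = 2) := fun h =>
      hnot ⟨fun q hq => (h1 q hq).trans h.1, fun q hq => (h2 q hq).trans h.2⟩
    split_ifs <;> omega

/-- While a run of descents of level `j + 1` is read, some level `j` block is read entirely. -/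
theorem exists_block_read {a i j o s₁ s₂ : ℕ} (ha : 0 < a)
    (hs : IsSweep lab (blockLength a (4 * w + 3) i) w c)
    (htop : IsBlock a (4 * w + 3) lab i 0) (hji : j ≤ i)
    (hK : o + (4 * w + 3) * a ^ j ≤ blockLength a (4 * w + 3) i) (hs₁₂ : s₁ ≤ s₂)
    (hlab : ∀ r < (4 * w + 3) * a ^ j, lab (o + r) = j + 1)
    (h0 : ∀ r < (4 * w + 3) * a ^ j, c s₁ (o + r) = 0)
    (h2 : ∀ r < (4 * w + 3) * a ^ j, c s₂ (o + r) = 2) :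
    ∃ o', IsBlock a (4 * w + 3) lab j o' ∧
      o' + blockLength a (4 * w + 3) j ≤ blockLength a (4 * w + 3) i ∧
      (∀ r < blockLength a (4 * w + 3) j, c s₁ (o' + r) = 0) ∧
      ∀ r < blockLength a (4 * w + 3) j, c s₂ (o' + r) = 2 := by
  set b := 4 * w + 3 with hb
  set K := blockLength a b i with hKdef
  set m := b * a ^ j with hm
  by_contra! hno
  have hrunlab : ∀ p ∈ Finset.Ico o (o + m), lab p = j + 1 := fun p hp => by
    rw [Finset.mem_Ico] at hp
    have := hlab (p - o) (by omega)
    rwa [Nat.add_sub_cancel' hp.1] at this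
  have hsum := htop.sum_le_sum (K := K)
    (F := fun p => (if c s₂ p = 2 then stepSign (lab p) else 0) -
      if c s₁ p = 2 then stepSign (lab p) else 0)
    (G := fun p => (a : ℤ) ^ j * ((if c s₁ p = 1 then 1 else 0) + if c s₂ p = 1 then 1 else 0) -
      if p ∈ Finset.Ico o (o + m) then 1 else 0)
    (fun o' hblock hK' => by
      refine (hs.block_change_le hs₁₂ hblock hK' fun h => ?_).trans_eq
        (Finset.sum_congr rfl fun r hr => ?_)
      · obtain ⟨r, hr, hr2⟩ := hno o' hblock hK' h.1
        exact hr2 (h.2 r hr)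
      · have hmem : o' + r ∉ Finset.Ico o (o + m) := fun hmem => by
          have h3 := hblock.label_le r (Finset.mem_range.1 hr)
          have h4 := hrunlab _ hmem
          omega
        simp only [if_neg hmem, sub_zero])
    (fun p hp => by
      have h3 : c s₁ p ≤ c s₂ p := hs.mono p hs₁₂
      have h4 := hs.le_two s₂ p
      have h5 : stepSign (lab p) = -1 := by rw [stepSign, if_neg (by omega)]
      have h6 : (0 : ℤ) ≤ (a : ℤ) ^ j * ((if c s₁ p = 1 then 1 else 0) +
          if c s₂ p = 1 then 1 else 0) := by
        refine mul_nonneg (by positivity) ?_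
        split_ifs <;> norm_num
      have h7 : p ∈ Finset.Ico o (o + m) → c s₁ p = 0 ∧ c s₂ p = 2 := fun hmem => by
        rw [Finset.mem_Ico] at hmem
        have h8 := h0 (p - o) (by omega)
        have h9 := h2 (p - o) (by omega)
        rw [Nat.add_sub_cancel' hmem.1] at h8 h9
        exact ⟨h8, h9⟩
      simp only [h5]
      by_cases hmem : p ∈ Finset.Ico o (o + m)
      · simp [h7 hmem, hmem]
      · rw [if_neg hmem, sub_zero]
        refine le_trans ?_ h6
        split_ifs <;> omega)
    hji (by rw [zero_add])
  simp only [zero_add, Finset.sum_sub_distrib, ← Finset.mul_sum, Finset.sum_add_distrib,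
    Finset.sum_boole, ← hKdef] at hsum
  have hfilter : (Finset.range K).filter (fun p => p ∈ Finset.Ico o (o + m)) =
      Finset.Ico o (o + m) := by
    ext p
    simp only [Finset.mem_filter, Finset.mem_range, Finset.mem_Ico]
    omega
  rw [hfilter, Nat.card_Ico, Nat.add_sub_cancel_left] at hsum
  have hn₁ := abs_le.1 (hs.net s₁)
  have hn₂ := abs_le.1 (hs.net s₂)
  have hf₁ : ((((Finset.range K).filter fun p => c s₁ p = 1).card : ℕ) : ℤ) ≤ w := by
    exact_mod_cast hs.few s₁
  have hf₂ : ((((Finset.range K).filter fun p => c s₂ p = 1).card : ℕ) : ℤ) ≤ w := by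
    exact_mod_cast hs.few s₂
  have hpow : (1 : ℤ) ≤ (a : ℤ) ^ j := one_le_pow₀ (by exact_mod_cast ha)
  have hmul := mul_le_mul_of_nonneg_left (add_le_add hf₁ hf₂) (zero_le_one.trans hpow)
  have hmcast : (m : ℤ) = (4 * w + 3) * (a : ℤ) ^ j := by rw [hm, hb]; push_cast; ring
  nlinarith [hn₁.1, hn₁.2, hn₂.1, hn₂.2]

/-- While a level `j` block is read, there is a time at which each of the labels `0, …, j` occurs
at a partially read position. -/
theorem exists_partial_labels {a i j o t₁ t₂ : ℕ} (ha : 0 < a)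
    (hs : IsSweep lab (blockLength a (4 * w + 3) i) w c)
    (htop : IsBlock a (4 * w + 3) lab i 0) (hji : j ≤ i)
    (hblock : IsBlock a (4 * w + 3) lab j o)
    (hK : o + blockLength a (4 * w + 3) j ≤ blockLength a (4 * w + 3) i)
    (h0 : ∀ r < blockLength a (4 * w + 3) j, c t₁ (o + r) = 0)
    (h2 : ∀ r < blockLength a (4 * w + 3) j, c t₂ (o + r) = 2) :
    ∃ t, t₁ < t ∧ t < t₂ ∧ ∀ l ≤ j, ∃ p < blockLength a (4 * w + 3) i, lab p = l ∧ c t p = 1 := by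
  induction j generalizing o t₁ t₂ with
  | zero =>
    obtain ⟨s₁, s₂, hs₁, hs₂, h3, h4, h5⟩ := hs.exists_interval one_pos hK h0 h2
    have h6 := h3 0 one_pos
    have h7 := h4 0 one_pos
    have hlt : s₁ < s₂ := by
      by_contra! hle
      have : c s₂ (o + 0) ≤ c s₁ (o + 0) := hs.mono (o + 0) hle
      omega
    have hlt' : s₁ + 1 < s₂ := by
      rcases Nat.lt_or_ge (s₁ + 1) s₂ with h | h
      · exact h
      · obtain rfl : s₂ = s₁ + 1 := by omega
        exact absurd h7 (hs.step s₁ (o + 0) (by rw [blockLength] at hK; omega) h6)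
    obtain ⟨r, hr, hr1⟩ := h5 (s₁ + 1) (Nat.lt_succ_self _) hlt'
    obtain rfl : r = 0 := by omega
    refine ⟨s₁ + 1, by omega, by omega, fun l hl => ⟨o, ?_, ?_, hr1⟩⟩
    · rw [blockLength] at hK
      omega
    · rw [Nat.le_zero.1 hl]
      exact hblock
  | succ j ih =>
    have hlen : blockLength a (4 * w + 3) (j + 1) =
      a * blockLength a (4 * w + 3) j + (4 * w + 3) * a ^ j := rfl
    obtain ⟨s₁, s₂, hs₁, hs₂, h3, h4, h5⟩ := hs.exists_interval (t₁ := t₁) (t₂ := t₂)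
      (o := o + a * blockLength a (4 * w + 3) j) (m := (4 * w + 3) * a ^ j) (by positivity)
      (by omega) (fun r hr => by rw [add_assoc]; exact h0 _ (by omega))
      (fun r hr => by rw [add_assoc]; exact h2 _ (by omega))
    have hle : s₁ ≤ s₂ := by
      by_contra! hlt
      have hm : 0 < (4 * w + 3) * a ^ j := by positivity
      have h6 := h3 0 hm
      have h7 := h4 0 hm
      have := hs.mono (o + a * blockLength a (4 * w + 3) j + 0) hlt.le
      simp only at this
      omega
    obtain ⟨o', hb', hK', h0', h2'⟩ := exists_block_read ha hs htop (by omega) (by omega) hle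
      hblock.2 h3 h4
    obtain ⟨t, ht₁, ht₂, ht⟩ := ih (by omega) hb' hK' h0' h2'
    refine ⟨t, by omega, by omega, fun l hl => ?_⟩
    rcases Nat.lt_or_ge j l with hlt | hge
    · obtain ⟨r, hr, hr1⟩ := h5 t ht₁ ht₂
      exact ⟨_, by omega, (hblock.2 r hr).trans (by omega), hr1⟩
    · exact ht l hge

/-- The hard sequence of level `w` has no sweep with at most `w` partially read positions. -/
theorem not_block {a t₁ t₂ : ℕ} (ha : 0 < a)
    (hs : IsSweep lab (blockLength a (4 * w + 3) w) w c)
    (htop : IsBlock a (4 * w + 3) lab w 0)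
    (h0 : ∀ p < blockLength a (4 * w + 3) w, c t₁ p = 0)
    (h2 : ∀ p < blockLength a (4 * w + 3) w, c t₂ p = 2) : False := by
  obtain ⟨t, -, -, ht⟩ := exists_partial_labels ha hs htop le_rfl htop (by rw [zero_add])
    (by simpa using h0) (by simpa using h2)
  have hsub : Finset.range (w + 1) ⊆ ((Finset.range (blockLength a (4 * w + 3) w)).filter
      fun p => c t p = 1).image lab := by
    intro l hl
    obtain ⟨p, hp, hpl, hp1⟩ := ht l (by have := Finset.mem_range.1 hl; omega)
    exact Finset.mem_image.2 ⟨p, Finset.mem_filter.2 ⟨Finset.mem_range.2 hp, hp1⟩, hpl⟩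
  have := (Finset.card_le_card hsub).trans Finset.card_image_le
  rw [Finset.card_range] at this
  exact absurd (this.trans (hs.few t)) (by omega)

end IsSweep

/-- The vertices `v 0 < v 1 < … < v (K + 1)` form a monotone path from `0` to `n - 1`. -/
structure IsMonotonePath {n : ℕ} (K : ℕ) (v : ℕ → Fin n) : Prop where
  zero : (v 0 : ℕ) = 0
  last : (v (K + 1) : ℕ) = n - 1
  lt_succ : ∀ t ≤ K, v t < v (t + 1)

open Classical in
/-- The Parikh vector of a run along the path `v` that uses every letter `a i` at an inner vertex
`i` of the path exactly `X` times. -/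
noncomputable def pathVector {n : ℕ} (K X : ℕ) (v : ℕ → Fin n) : Alph n → ℕ
  | .c i j => if ∃ t ≤ K, v t = i ∧ v (t + 1) = j then 1 else 0
  | .a i => if ∃ p < K, v (p + 1) = i then X else 0

namespace IsMonotonePath

variable {n K X : ℕ} {v : ℕ → Fin n}

theorem strictMonoOn (hv : IsMonotonePath K v) : StrictMonoOn v (Set.Iic (K + 1)) :=
  strictMonoOn_Iic_of_lt_succ fun t ht => hv.lt_succ t (Nat.lt_succ_iff.1 ht)

theorem inj (hv : IsMonotonePath K v) {s t : ℕ} (hs : s ≤ K + 1) (ht : t ≤ K + 1)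
    (h : v s = v t) : s = t :=
  hv.strictMonoOn.injOn hs ht h

theorem sum_ite_mem (hv : IsMonotonePath K v) (φ : Fin n → ℤ) :
    open Classical in
    ∑ i, (if ∃ p < K, v (p + 1) = i then φ i else 0) = ∑ p ∈ Finset.range K, φ (v (p + 1)) := by
  classical
  rw [← Finset.sum_filter]
  have himage : Finset.univ.filter (fun i => ∃ p < K, v (p + 1) = i) =
      (Finset.range K).image fun p => v (p + 1) := by
    ext i
    simp
  rw [himage, Finset.sum_image fun p hp q hq h => ?_]
  have hp := Finset.mem_range.1 hp
  have hq := Finset.mem_range.1 hq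
  have := hv.inj (by omega) (by omega) h
  omega

theorem sum_pathVector (hv : IsMonotonePath K v) (P : Fin n → Prop) [DecidablePred P] :
    ∑ i ∈ Finset.univ.filter P, (-1 : ℤ) ^ (i : ℕ) * (pathVector K X v (.a i) : ℤ) =
      X * ∑ p ∈ Finset.range K, if P (v (p + 1)) then (-1 : ℤ) ^ (v (p + 1) : ℕ) else 0 := by
  classical
  rw [Finset.mul_sum, ← hv.sum_ite_mem fun i => (X : ℤ) * if P i then (-1) ^ (i : ℕ) else 0,
    Finset.sum_filter]
  refine Finset.sum_congr rfl fun i _ => ?_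
  simp only [pathVector]
  split_ifs <;> simp [mul_comm]

theorem exists_sum_le_eq (hv : IsMonotonePath K v) (f : ℕ → ℤ) (k : ℕ) :
    ∃ q ≤ K, ∑ p ∈ Finset.range K, (if (v (p + 1) : ℕ) ≤ k then f p else 0) =
      ∑ p ∈ Finset.range q, f p := by
  have hmono : ∀ p q, p ≤ q → q < K → (v (p + 1) : ℕ) ≤ v (q + 1) := fun p q hpq hq =>
    hv.strictMonoOn.monotoneOn (Set.mem_Iic.2 (by omega)) (Set.mem_Iic.2 (by omega))
      (Nat.succ_le_succ hpq)
  suffices h : ∀ m ≤ K, ∃ q ≤ m, ∑ p ∈ Finset.range m, (if (v (p + 1) : ℕ) ≤ k then f p else 0) =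
      ∑ p ∈ Finset.range q, f p from h K le_rfl
  intro m hm
  induction m with
  | zero => exact ⟨0, le_rfl, rfl⟩
  | succ m ih =>
    by_cases hk : (v (m + 1) : ℕ) ≤ k
    · refine ⟨m + 1, le_rfl, Finset.sum_congr rfl fun p hp => if_pos ?_⟩
      have := Finset.mem_range.1 hp
      exact (hmono p m (by omega) hm).trans hk
    · obtain ⟨q, hq, h⟩ := ih (by omega)
      exact ⟨q, by omega, by rw [Finset.sum_range_succ, if_neg hk, add_zero, h]⟩

theorem pathVector_mem (hv : IsMonotonePath K v)
    (hsum : ∑ p ∈ Finset.range K, (-1 : ℤ) ^ (v (p + 1) : ℕ) = 0)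
    (hpartial : ∀ q ≤ K, 0 ≤ ∑ p ∈ Finset.range q, (-1 : ℤ) ^ (v (p + 1) : ℕ)) :
    pathVector K X v ∈ UniversalOCA n := by
  classical
  have hc : ∀ i j, pathVector K X v (.c i j) = 1 ↔ ∃ t ≤ K, v t = i ∧ v (t + 1) = j :=
    fun i j => by simp [pathVector]
  refine ⟨fun i j hij => ?_, fun i j => ?_, ⟨K + 1, fun t => v t, ?_, ?_, ?_, fun i j => ?_⟩, ?_,
    fun k _ => ?_, fun j hj => ?_⟩
  · simp only [pathVector, ite_eq_right_iff, one_ne_zero, imp_false]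
    rintro ⟨t, ht, rfl, rfl⟩
    exact hij (hv.lt_succ t ht)
  · simp only [pathVector]
    split_ifs <;> omega
  · exact fun s t hst => hv.strictMonoOn (Set.mem_Iic.2 (by omega)) (Set.mem_Iic.2 (by omega)) hst
  · simpa using hv.zero
  · simpa using hv.last
  · refine (hc i j).trans ⟨?_, ?_⟩
    · rintro ⟨t, ht, h⟩
      exact ⟨⟨t, by omega⟩, by simpa using h⟩
    · rintro ⟨t, h⟩
      exact ⟨t, by omega, by simpa using h⟩
  · have := hv.sum_pathVector (X := X) fun _ => True
    simpa [hsum] using this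
  · rw [hv.sum_pathVector]
    obtain ⟨q, hq, h⟩ := hv.exists_sum_le_eq (fun p => (-1 : ℤ) ^ (v (p + 1) : ℕ)) k
    rw [h]
    exact mul_nonneg (by positivity) (hpartial q hq)
  · have hj' : ∃ p < K, v (p + 1) = j := by
      by_contra h
      simp [pathVector, h] at hj
    obtain ⟨p, hp, rfl⟩ := hj'
    exact ⟨fun _ => ⟨v p, (hc _ _).2 ⟨p, by omega, rfl, rfl⟩⟩,
      fun _ => ⟨v (p + 2), (hc _ _).2 ⟨p + 1, by omega, rfl, rfl⟩⟩⟩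

end IsMonotonePath

/-- The letter `l` mentions the vertex `i`. -/
def Alph.Mentions {n : ℕ} (i : Fin n) : Alph n → Prop
  | .c j k => j = i ∨ k = i
  | .a j => j = i

theorem eq_of_mem_universalOCA {n : ℕ} {f : Alph n → ℕ} (hf : f ∈ UniversalOCA n)
    {i i' j : Fin n} (hi : f (.c i j) = 1) (hi' : f (.c i' j) = 1) : i = i' := by
  obtain ⟨-, -, ⟨k, v, hv, -, -, h⟩, -⟩ := hf
  obtain ⟨s, rfl, hs⟩ := (h i j).1 hi
  obtain ⟨t, rfl, ht⟩ := (h i' j).1 hi'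
  rw [Fin.succ_inj.1 (hv.injective (hs.trans ht.symm))]

/-- In a vector of the universal one-counter set, every mentioned vertex other than `0` has an
incoming edge. -/
theorem exists_edge_of_mentions {n : ℕ} {f : Alph n → ℕ} (hf : f ∈ UniversalOCA n)
    {i : Fin n} (hi : 0 < (i : ℕ)) {l : Alph n} (hl : l.Mentions i) (hfl : 0 < f l) :
    ∃ j, f (.c j i) = 1 := by
  obtain ⟨-, hle, ⟨k, v, hv, h0, -, h⟩, -, -, hU4⟩ := hf
  have hedge : ∀ {i j}, 0 < f (.c i j) → f (.c i j) = 1 := fun {i j} hij =>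
    le_antisymm (hle i j) hij
  match l, hl with
  | .c j _, .inr rfl => exact ⟨j, hedge hfl⟩
  | .c _ j, .inl rfl =>
    obtain ⟨t, rfl, -⟩ := (h _ _).1 (hedge hfl)
    have ht : t.castSucc ≠ 0 := fun ht => by
      rw [ht] at hi
      omega
    obtain ⟨s, hs⟩ := Fin.exists_succ_eq.2 ht
    exact ⟨v s.castSucc, (h _ _).2 ⟨s, rfl, by rw [hs]⟩⟩
  | .a _, rfl => exact (hU4 _ hfl).1 hi

/-- The signed number of letters `a i` in a word. -/
def netCount {n : ℕ} (u : List (Alph n)) : ℤ :=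
  ∑ i : Fin n, (-1 : ℤ) ^ (i : ℕ) * (u.count (.a i) : ℤ)

theorem netCount_append {n : ℕ} (u v : List (Alph n)) :
    netCount (u ++ v) = netCount u + netCount v := by
  simp [netCount, ← Finset.sum_add_distrib, mul_add]

/-- The automaton has an accepting run that is in state `q` after reading `u`, and then reads
`v`. -/
def NFA.Splits {α σ : Type*} (M : NFA α σ) (q : σ) (u v : List α) : Prop :=
  q ∈ M.eval u ∧ v ∈ M.acceptsFrom {q}

namespace NFA.Splits

theorem append_mem {α σ : Type*} {M : NFA α σ} {q : σ} {u u' v v' : List α}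
    (h : M.Splits q u v) (h' : M.Splits q u' v') : u ++ v' ∈ M.accepts := by
  rw [accepts_eq_acceptsFrom_start, append_mem_acceptsFrom]
  obtain ⟨s, hs, hsv⟩ := mem_acceptsFrom.1 h'.2
  exact mem_acceptsFrom.2 ⟨s, hs, mem_evalFrom_iff_exists.2 ⟨q, h.1, hsv⟩⟩

theorem exists_of_append_mem {α σ : Type*} {M : NFA α σ} {u v : List α}
    (h : u ++ v ∈ M.accepts) : ∃ q, M.Splits q u v := by
  rw [accepts_eq_acceptsFrom_start, append_mem_acceptsFrom] at h
  obtain ⟨s, hs, hsv⟩ := mem_acceptsFrom.1 h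
  obtain ⟨q, hq, hqv⟩ := mem_evalFrom_iff_exists.1 hsv
  exact ⟨q, hq, mem_acceptsFrom.2 ⟨s, hs, hqv⟩⟩

variable {n : ℕ} {Q : Type*} {M : NFA (Alph n) Q} {q : Q} {u u' v v' : List (Alph n)}

theorem count_mem (hM : ParikhImage M = UniversalOCA n) (h : M.Splits q u v)
    (h' : M.Splits q u' v') : (fun l => (u ++ v').count l) ∈ UniversalOCA n :=
  hM ▸ ⟨u ++ v', h.append_mem h', fun _ => rfl⟩

theorem netCount_eq (hM : ParikhImage M = UniversalOCA n) (h : M.Splits q u v)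
    (h' : M.Splits q u' v') : netCount u = netCount u' := by
  have h1 : netCount (u ++ v) = 0 := (h.count_mem hM h).2.2.2.1
  have h2 : netCount (u' ++ v) = 0 := (h'.count_mem hM h).2.2.2.1
  rw [netCount_append] at h1 h2
  omega

theorem exists_netCount_le [Fintype Q] (hM : ParikhImage M = UniversalOCA n) :
    ∃ X : ℕ, 0 < X ∧ ∀ q u v, M.Splits q u v → |netCount u| ≤ X := by
  classical
  have hq : ∀ q, ∃ m : ℕ, ∀ u v, M.Splits q u v → |netCount u| ≤ m := fun q => by
    by_cases hex : ∃ u v, M.Splits q u v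
    · obtain ⟨u', v', h'⟩ := hex
      refine ⟨(netCount u').natAbs, fun u v h => ?_⟩
      rw [h.netCount_eq hM h', Int.natCast_natAbs]
    · exact ⟨0, fun u v h => absurd ⟨u, v, h⟩ hex⟩
  choose m hm using hq
  refine ⟨∑ q, m q + 1, Nat.succ_pos _, fun q u v h => (hm q u v h).trans ?_⟩
  have := Finset.single_le_sum (fun q _ => Nat.zero_le (m q)) (Finset.mem_univ q)
  exact_mod_cast this.trans (Nat.le_succ _)

/-- If a vertex is mentioned both before and after visiting the state `q`, then it has an
incoming edge in every accepting run through `q`. -/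
theorem exists_edge_mem (hM : ParikhImage M = UniversalOCA n) {i : Fin n} (hi : 0 < (i : ℕ))
    (h : M.Splits q u v) (hu : ∃ l ∈ u, l.Mentions i) (hv : ∃ l ∈ v, l.Mentions i)
    (h' : M.Splits q u' v') : ∃ j, .c j i ∈ u' ++ v' := by
  obtain ⟨l, hlu, hl⟩ := hu
  obtain ⟨l', hlv, hl'⟩ := hv
  have hmem : ∀ {l : Alph n} {x : List (Alph n)}, x.count l = 1 → l ∈ x := fun hx =>
    List.count_pos_iff.1 (hx ▸ one_pos)
  obtain ⟨j, hj⟩ := exists_edge_of_mentions (h.count_mem hM h) hi hl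
    (List.count_pos_iff.2 (List.mem_append_left v hlu))
  have hU1 : (u ++ v).count (.c j i) ≤ 1 := (h.count_mem hM h).2.1 j i
  rcases List.mem_append.1 (hmem hj) with hju | hjv
  · obtain ⟨k, hk⟩ := exists_edge_of_mentions (h'.count_mem hM h) hi hl'
      (List.count_pos_iff.2 (List.mem_append_right u' hlv))
    rcases List.mem_append.1 (hmem hk) with hku | hkv
    · exact ⟨k, List.mem_append_left _ hku⟩
    · obtain rfl : k = j := by
        refine eq_of_mem_universalOCA (h.count_mem hM h) ?_ hj
        exact le_antisymm ((h.count_mem hM h).2.1 k i)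
          (List.count_pos_iff.2 (List.mem_append_right u hkv))
      have h1 := List.count_pos_iff.2 hju
      have h2 := List.count_pos_iff.2 hkv
      rw [List.count_append] at hU1
      omega
  · obtain ⟨k, hk⟩ := exists_edge_of_mentions (h.count_mem hM h') hi hl
      (List.count_pos_iff.2 (List.mem_append_left v' hlu))
    rcases List.mem_append.1 (hmem hk) with hku | hkv
    · obtain rfl : k = j := by
        refine eq_of_mem_universalOCA (h.count_mem hM h) ?_ hj
        exact le_antisymm ((h.count_mem hM h).2.1 k i)
          (List.count_pos_iff.2 (List.mem_append_left v hku))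
      have h1 := List.count_pos_iff.2 hku
      have h2 := List.count_pos_iff.2 hjv
      rw [List.count_append] at hU1
      omega
    · exact ⟨k, List.mem_append_right _ hkv⟩

end NFA.Splits

open Classical in
/-- How much of the vertex `v (p + 1)` has been read after `t` letters of `x`: nothing (`0`), a
part (`1`), or everything (`2`). -/
noncomputable def readState {n : ℕ} (v : ℕ → Fin n) (x : List (Alph n)) (t p : ℕ) : ℕ :=
  if ∃ l ∈ x.take t, l.Mentions (v (p + 1)) then
    if ∃ l ∈ x.drop t, l.Mentions (v (p + 1)) then 1 else 2
  else 0

section readState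

variable {n K X : ℕ} {v : ℕ → Fin n} {x : List (Alph n)}

theorem readState_eq_one {t p : ℕ} : readState v x t p = 1 ↔
    (∃ l ∈ x.take t, l.Mentions (v (p + 1))) ∧ ∃ l ∈ x.drop t, l.Mentions (v (p + 1)) := by
  unfold readState
  split_ifs <;> simp_all

theorem not_mentions_of_readState_eq_zero {t p : ℕ} (h : readState v x t p = 0) :
    ∀ l ∈ x.take t, ¬ l.Mentions (v (p + 1)) := by
  unfold readState at h
  split_ifs at h with h₁
  exact fun l hl hm => h₁ ⟨l, hl, hm⟩

theorem not_mentions_of_readState_eq_two {t p : ℕ} (h : readState v x t p = 2) :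
    ∀ l ∈ x.drop t, ¬ l.Mentions (v (p + 1)) := by
  intro l hl hm
  have hd : ∃ l ∈ x.drop t, l.Mentions (v (p + 1)) := ⟨l, hl, hm⟩
  unfold readState at h
  rw [if_pos hd] at h
  split_ifs at h
  omega

theorem edge_mem (hx : ∀ l, x.count l = pathVector K X v l) {t : ℕ} (ht : t ≤ K) :
    Alph.c (v t) (v (t + 1)) ∈ x := by
  rw [← List.count_pos_iff, hx]
  simp only [pathVector]
  rw [if_pos ⟨t, ht, rfl, rfl⟩]
  exact one_pos

theorem monotone_readState (p : ℕ) : Monotone fun t => readState v x t p := by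
  intro s t hst
  have h1 : (∃ l ∈ x.take s, l.Mentions (v (p + 1))) → ∃ l ∈ x.take t, l.Mentions (v (p + 1)) :=
    fun ⟨l, hl, h⟩ => ⟨l, (List.take_sublist_take_left hst).subset hl, h⟩
  have h2 : (∃ l ∈ x.drop t, l.Mentions (v (p + 1))) → ∃ l ∈ x.drop s, l.Mentions (v (p + 1)) :=
    fun ⟨l, hl, h⟩ => ⟨l, (List.drop_sublist_drop_left x hst).subset hl, h⟩
  simp only [readState]
  split_ifs <;> first | omega | exact absurd (h1 ‹_›) ‹_› | exact absurd (h2 ‹_›) ‹_›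

theorem readState_succ_ne_two (hv : IsMonotonePath K v)
    (hx : ∀ l, x.count l = pathVector K X v l) {t p : ℕ} (hp : p < K)
    (h : readState v x t p = 0) : readState v x (t + 1) p ≠ 2 := by
  intro h2
  have hget : ∀ l ∈ x, l.Mentions (v (p + 1)) → x[t]? = some l := fun l hl hm => by
    rw [← List.take_append_drop t x, List.mem_append] at hl
    have hl := hl.resolve_left fun hl => not_mentions_of_readState_eq_zero h l hl hm
    have ht : t < x.length := by
      by_contra! hle
      rw [List.drop_eq_nil_of_le hle] at hl
      exact List.not_mem_nil hl
    rw [List.drop_eq_getElem_cons ht, List.mem_cons] at hl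
    have hl := hl.resolve_right fun hl => not_mentions_of_readState_eq_two h2 l hl hm
    rw [hl, List.getElem?_eq_getElem ht]
  have h3 := hget _ (edge_mem hx hp.le) (.inr rfl)
  have h4 := hget _ (edge_mem hx (show p + 1 ≤ K by omega)) (.inl rfl)
  rw [h3, Option.some_inj, Alph.c.injEq] at h4
  exact (hv.lt_succ p hp.le).ne h4.1

theorem readState_eq_of_adjacent (hx : ∀ l, x.count l = pathVector K X v l) {t p : ℕ}
    (hp : p + 1 < K) : ¬ (readState v x t p = 0 ∧ readState v x t (p + 1) = 2) ∧
      ¬ (readState v x t p = 2 ∧ readState v x t (p + 1) = 0) := by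
  have hmem := edge_mem hx hp.le
  rw [← List.take_append_drop t x, List.mem_append] at hmem
  constructor <;> rintro ⟨h, h'⟩
  · rcases hmem with hmem | hmem
    · exact not_mentions_of_readState_eq_zero h _ hmem (.inl rfl)
    · exact not_mentions_of_readState_eq_two h' _ hmem (.inr rfl)
  · rcases hmem with hmem | hmem
    · exact not_mentions_of_readState_eq_zero h' _ hmem (.inr rfl)
    · exact not_mentions_of_readState_eq_two h _ hmem (.inl rfl)

theorem netCount_take (hv : IsMonotonePath K v) (hx : ∀ l, x.count l = pathVector K X v l)
    (t : ℕ) : netCount (x.take t) = ∑ p ∈ Finset.range K,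
      (-1 : ℤ) ^ (v (p + 1) : ℕ) * ((x.take t).count (.a (v (p + 1))) : ℤ) := by
  classical
  rw [netCount, ← hv.sum_ite_mem fun i => (-1 : ℤ) ^ (i : ℕ) * ((x.take t).count (.a i) : ℤ)]
  refine Finset.sum_congr rfl fun i _ => ?_
  split_ifs with h
  · rfl
  · have h1 : x.count (.a i) = 0 := by
      rw [hx]
      simp only [pathVector]
      exact if_neg h
    have h2 := (List.take_sublist t x).count_le (.a i)
    rw [h1, Nat.le_zero] at h2
    rw [h2, Nat.cast_zero, mul_zero]

theorem abs_sum_readState_eq_two_le (hv : IsMonotonePath K v)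
    (hx : ∀ l, x.count l = pathVector K X v l) (hX : 0 < X) {t : ℕ}
    (hnet : |netCount (x.take t)| ≤ X) :
    |∑ p ∈ Finset.range K, if readState v x t p = 2 then (-1 : ℤ) ^ (v (p + 1) : ℕ) else 0| ≤
      ((Finset.range K).filter fun p => readState v x t p = 1).card + 1 := by
  have hX' : (0 : ℤ) < X := by exact_mod_cast hX
  have hterm : ∀ p ∈ Finset.range K,
      |(X : ℤ) * (if readState v x t p = 2 then (-1 : ℤ) ^ (v (p + 1) : ℕ) else 0) -
        (-1 : ℤ) ^ (v (p + 1) : ℕ) * ((x.take t).count (.a (v (p + 1))) : ℤ)| ≤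
      X * if readState v x t p = 1 then 1 else 0 := fun p hp => by
    have hcount : x.count (.a (v (p + 1))) = X := by
      rw [hx]
      simp only [pathVector]
      exact if_pos ⟨p, Finset.mem_range.1 hp, rfl⟩
    have hle := (List.take_sublist t x).count_le (.a (v (p + 1)))
    have hsplit := congrArg (List.count (.a (v (p + 1)))) (List.take_append_drop t x)
    rw [List.count_append, hcount] at hsplit
    by_cases h0 : readState v x t p = 0
    · have : (x.take t).count (.a (v (p + 1))) = 0 := List.count_eq_zero.2 fun hmem =>
        not_mentions_of_readState_eq_zero h0 _ hmem rfl
      simp [h0, this]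
    by_cases h2 : readState v x t p = 2
    · have : (x.drop t).count (.a (v (p + 1))) = 0 := List.count_eq_zero.2 fun hmem =>
        not_mentions_of_readState_eq_two h2 _ hmem rfl
      rw [this, add_zero] at hsplit
      simp [h2, hsplit, mul_comm]
    have h1 : readState v x t p = 1 := by
      unfold readState at h0 h2 ⊢
      split_ifs at h0 h2 ⊢ <;> simp_all
    rw [if_neg h2, if_pos h1, mul_zero, zero_sub, abs_neg, abs_mul, abs_pow, abs_neg, abs_one,
      one_pow, one_mul, mul_one, Nat.abs_cast]
    exact_mod_cast hle.trans hcount.le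
  have hsum := (Finset.abs_sum_le_sum_abs _ _).trans (Finset.sum_le_sum hterm)
  rw [Finset.sum_sub_distrib, ← netCount_take hv hx, ← Finset.mul_sum, ← Finset.mul_sum,
    Finset.sum_boole] at hsum
  refine le_of_mul_le_mul_left ?_ hX'
  calc _ = |(X : ℤ) * ∑ p ∈ Finset.range K,
        if readState v x t p = 2 then (-1 : ℤ) ^ (v (p + 1) : ℕ) else 0| := by
        rw [abs_mul, Nat.abs_cast]
    _ ≤ _ := by
        have := abs_sub_abs_le_abs_sub ((X : ℤ) * ∑ p ∈ Finset.range K,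
          if readState v x t p = 2 then (-1 : ℤ) ^ (v (p + 1) : ℕ) else 0) (netCount (x.take t))
        rw [mul_add, mul_one]
        linarith

theorem isSweep_readState {w : ℕ} {lab : ℕ → ℕ} (hv : IsMonotonePath K v)
    (hx : ∀ l, x.count l = pathVector K X v l) (hX : 0 < X)
    (hlab : ∀ p < K, (-1 : ℤ) ^ (v (p + 1) : ℕ) = stepSign (lab p))
    (hnet : ∀ t, |netCount (x.take t)| ≤ X)
    (hfew : ∀ t, ((Finset.range K).filter fun p => readState v x t p = 1).card ≤ w) :
    IsSweep lab K w (readState v x) where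
  le_two t p := by
    unfold readState
    split_ifs <;> omega
  mono := monotone_readState
  step _ _ hp := readState_succ_ne_two hv hx hp
  adj_zero _ _ hp h h' := (readState_eq_of_adjacent hx hp).1 ⟨h, h'⟩
  adj_two _ _ hp h h' := (readState_eq_of_adjacent hx hp).2 ⟨h, h'⟩
  few := hfew
  net t := by
    have := abs_sum_readState_eq_two_le hv hx hX (hnet t)
    rw [Finset.sum_congr rfl fun p hp => by rw [hlab p (Finset.mem_range.1 hp)]] at this
    refine this.trans ?_
    exact_mod_cast Nat.succ_le_succ (hfew t)

end readState

/-- A map on functions `Fin K → Fin g` each of whose fibres determines, for every one of its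
members, `m` of the values takes at least `g ^ m` values. -/
theorem pow_le_card_of_agree {K g m : ℕ} {Q : Type*} [Fintype Q] (hg : 0 < g)
    (f : (Fin K → Fin g) → Q) (P : (Fin K → Fin g) → Finset (Fin K)) (hP : ∀ y, (P y).card = m)
    (h : ∀ y y', f y = f y' → ∀ p ∈ P y, y' p = y p) : g ^ m ≤ Fintype.card Q := by
  classical
  have hmK : m ≤ K := by
    simpa [hP] using Finset.card_le_univ (P fun _ => ⟨0, hg⟩)
  have hfibre : ∀ q ∈ Finset.univ.image f,
      (Finset.univ.filter fun y => f y = q).card ≤ g ^ (K - m) := fun q hq => by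
    obtain ⟨y, -, rfl⟩ := Finset.mem_image.1 hq
    have hsub : (Finset.univ.filter fun y' => f y' = f y) ⊆
        Fintype.piFinset fun p => if p ∈ P y then {y p} else Finset.univ := fun y' hy' => by
      rw [Fintype.mem_piFinset]
      intro p
      split_ifs with hp
      · exact Finset.mem_singleton.2 (h y y' (Finset.mem_filter.1 hy').2.symm p hp)
      · exact Finset.mem_univ _
    refine (Finset.card_le_card hsub).trans_eq ?_
    rw [Fintype.card_piFinset]
    simp only [apply_ite Finset.card, Finset.card_singleton, Finset.card_univ, Fintype.card_fin,
      Finset.prod_ite, Finset.prod_const_one, Finset.prod_const, one_mul]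
    rw [Finset.filter_not, Finset.filter_mem_eq_inter, Finset.univ_inter,
      Finset.card_univ_sdiff, hP, Fintype.card_fin]
  have hcard := (Finset.card_le_mul_card_image _ _ hfibre).trans
    (Nat.mul_le_mul_left _ (Finset.card_le_univ _))
  rw [Finset.card_univ, Fintype.card_fun, Fintype.card_fin, Fintype.card_fin,
    ← Nat.sub_add_cancel hmK, Nat.add_sub_cancel, pow_add] at hcard
  exact Nat.le_of_mul_le_mul_left hcard (by positivity)

/-- Each accepting run for a path with hard labels visits a state at which more than `w` vertices
of the path have been partially read. -/
theorem exists_splits_mentions {n X w : ℕ} (hw : 0 < w) {Q : Type*} {M : NFA (Alph n) Q}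
    {v : ℕ → Fin n}
    (hv : IsMonotonePath (blockLength ((4 * w + 3) * w) (4 * w + 3) w) v)
    (hlab : ∀ p < blockLength ((4 * w + 3) * w) (4 * w + 3) w, (-1 : ℤ) ^ (v (p + 1) : ℕ) =
      stepSign (blockLabel ((4 * w + 3) * w) (4 * w + 3) w p))
    (hM : ParikhImage M = UniversalOCA n) (hX : 0 < X)
    (hnet : ∀ q u u', M.Splits q u u' → |netCount u| ≤ X) :
    ∃ q u u', M.Splits q u u' ∧
      (∀ l, (u ++ u').count l =
        pathVector (blockLength ((4 * w + 3) * w) (4 * w + 3) w) X v l) ∧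
      ∃ P ⊆ Finset.range (blockLength ((4 * w + 3) * w) (4 * w + 3) w), P.card = w + 1 ∧
        ∀ p ∈ P, (∃ l ∈ u, l.Mentions (v (p + 1))) ∧ ∃ l ∈ u', l.Mentions (v (p + 1)) := by
  classical
  set b := 4 * w + 3
  set K := blockLength (b * w) b w
  have hblock := isBlock_blockLabel (b * w) b w
  have hpartial : ∀ q ≤ K, ∑ p ∈ Finset.range q, (-1 : ℤ) ^ (v (p + 1) : ℕ) =
      ∑ p ∈ Finset.range q, stepSign (blockLabel (b * w) b w (0 + p)) := fun q hq =>
    Finset.sum_congr rfl fun p hp => by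
      rw [zero_add, hlab p ((Finset.mem_range.1 hp).trans_le hq)]
  obtain ⟨x, hx, hcount⟩ : pathVector K X v ∈ ParikhImage M := by
    rw [hM]
    refine hv.pathVector_mem ?_ fun q hq => ?_
    · rw [hpartial K le_rfl]
      have := hblock.sum_stepSign
      rw [sub_self, zero_mul] at this
      exact (mul_eq_zero.1 this).resolve_left (by exact_mod_cast hw.ne')
    · rw [hpartial q hq]
      exact hblock.sum_range_nonneg_of_le hw le_rfl hq
  have hsplit : ∀ t, ∃ q, M.Splits q (x.take t) (x.drop t) := fun t =>
    NFA.Splits.exists_of_append_mem (by rwa [List.take_append_drop])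
  obtain ⟨t, ht⟩ : ∃ t, w + 1 ≤
      ((Finset.range K).filter fun p => readState v x t p = 1).card := by
    by_contra! hfew
    have hs := isSweep_readState hv (fun l => (hcount l).symm) hX hlab
      (fun t => (hsplit t).elim fun q hq => hnet q _ _ hq) fun t => Nat.lt_succ_iff.1 (hfew t)
    refine hs.not_block (t₁ := 0) (t₂ := x.length) (by positivity) hblock
      (fun p _ => by simp [readState]) fun p hp => ?_
    have hmem : ∃ l ∈ x, l.Mentions (v (p + 1)) :=
      ⟨_, edge_mem (fun l => (hcount l).symm) hp.le, .inr rfl⟩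
    unfold readState
    rw [List.take_length, List.drop_length, if_pos hmem, if_neg (by simp)]
  obtain ⟨P, hP, hPcard⟩ := Finset.exists_subset_card_eq ht
  obtain ⟨q, hq⟩ := hsplit t
  refine ⟨q, _, _, hq, fun l => by rw [List.take_append_drop, hcount], P,
    hP.trans (Finset.filter_subset _ _), hPcard, fun p hp => ?_⟩
  exact readState_eq_one.1 (Finset.mem_filter.1 (hP hp)).2

/-- The vertex with index `r` among the `g` candidates for position `p`; its parity is determined
by the label of `p`. -/
def candidate (g : ℕ) (lab : ℕ → ℕ) (p r : ℕ) : ℕ :=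
  2 * (g * p + r) + if lab p = 0 then 2 else 1

theorem neg_one_pow_candidate (g : ℕ) (lab : ℕ → ℕ) (p r : ℕ) :
    (-1 : ℤ) ^ candidate g lab p r = stepSign (lab p) := by
  unfold candidate stepSign
  split_ifs <;> simp [pow_add, pow_mul]

theorem candidate_lt_candidate {g : ℕ} (lab : ℕ → ℕ) {p r r' : ℕ} (hr : r < g) :
    candidate g lab p r < candidate g lab (p + 1) r' := by
  unfold candidate
  have : g * (p + 1) = g * p + g := Nat.mul_succ g p
  split_ifs <;> omega

theorem candidate_add_two_le {n g K : ℕ} (hn : 2 * (g * K) + 2 ≤ n) (lab : ℕ → ℕ) {p r : ℕ}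
    (hp : p < K) (hr : r < g) : candidate g lab p r + 2 ≤ n := by
  have := Nat.mul_le_mul_left g hp
  rw [Nat.succ_eq_add_one, mul_add] at this
  unfold candidate
  split_ifs <;> omega

theorem candidate_inj {g : ℕ} (lab : ℕ → ℕ) {p p' r r' : ℕ} (hr : r < g) (hr' : r' < g)
    (h : candidate g lab p r = candidate g lab p' r') : p = p' ∧ r = r' := by
  have h1 : g * p + r = g * p' + r' := by
    unfold candidate at h
    split_ifs at h <;> omega
  have hp : p = p' := by
    have := congrArg (· / g) h1
    simpa [Nat.mul_add_div (Nat.zero_lt_of_lt hr), Nat.div_eq_of_lt hr,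
      Nat.div_eq_of_lt hr'] using this
  subst hp
  exact ⟨rfl, by omega⟩

/-- The path from `0` to `n - 1` that visits, for each position `p < K`, the candidate chosen by
`y`. -/
def candidatePath {n g K : ℕ} (hn : 2 * (g * K) + 2 ≤ n) (lab : ℕ → ℕ) (y : Fin K → Fin g) :
    ℕ → Fin n
  | 0 => ⟨0, by omega⟩
  | p + 1 =>
    if hp : p < K then
      ⟨candidate g lab p (y ⟨p, hp⟩), by
        have := candidate_add_two_le hn lab hp (y ⟨p, hp⟩).isLt
        omega⟩
    else ⟨n - 1, by omega⟩

section candidatePath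

variable {n g K : ℕ} (hn : 2 * (g * K) + 2 ≤ n) (lab : ℕ → ℕ) (y : Fin K → Fin g)

theorem candidatePath_succ {p : ℕ} (hp : p < K) :
    (candidatePath hn lab y (p + 1) : ℕ) = candidate g lab p (y ⟨p, hp⟩) := by
  simp [candidatePath, hp]

theorem candidatePath_last : (candidatePath hn lab y (K + 1) : ℕ) = n - 1 := by
  simp [candidatePath]

theorem candidate_pos (p r : ℕ) : 0 < candidate g lab p r := by
  unfold candidate
  split_ifs <;> omega

theorem isMonotonePath_candidatePath : IsMonotonePath K (candidatePath hn lab y) where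
  zero := rfl
  last := candidatePath_last hn lab y
  lt_succ t ht := by
    rw [Fin.lt_def]
    rcases ht.lt_or_eq with ht | rfl
    · rw [candidatePath_succ hn lab y ht]
      cases t with
      | zero => exact candidate_pos lab _ _
      | succ t =>
        rw [candidatePath_succ hn lab y (by omega)]
        exact candidate_lt_candidate lab (Fin.isLt _)
    · rw [candidatePath_last]
      cases t with
      | zero =>
        simp only [candidatePath]
        omega
      | succ t =>
        rw [candidatePath_succ hn lab y (Nat.lt_succ_self t)]
        have := candidate_add_two_le hn lab (Nat.lt_succ_self t) (y ⟨t, Nat.lt_succ_self t⟩).isLt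
        omega

end candidatePath

theorem pow_succ_le_card {n g w : ℕ} (hw : 0 < w) (hg : 0 < g)
    (hn : 2 * (g * blockLength ((4 * w + 3) * w) (4 * w + 3) w) + 2 ≤ n)
    {Q : Type*} [Fintype Q] {M : NFA (Alph n) Q} (hM : ParikhImage M = UniversalOCA n) :
    g ^ (w + 1) ≤ Fintype.card Q := by
  classical
  set K := blockLength ((4 * w + 3) * w) (4 * w + 3) w
  set lab := blockLabel ((4 * w + 3) * w) (4 * w + 3) w
  obtain ⟨X, hX, hnet⟩ := NFA.Splits.exists_netCount_le hM
  have hpath := isMonotonePath_candidatePath hn lab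
  have hex := fun y => exists_splits_mentions hw (hpath y) (fun p hp => by
    rw [candidatePath_succ hn lab y hp, neg_one_pow_candidate]) hM hX hnet
  choose q u u' hsplit hcount P hPK hP hmentions using hex
  refine pow_le_card_of_agree hg q
    (fun y => (P y).attachFin fun p hp => Finset.mem_range.1 (hPK y hp))
    (fun y => by rw [Finset.card_attachFin, hP]) fun y y' hq p hp => ?_
  rw [Finset.mem_attachFin] at hp
  have hsplit' := hsplit y'
  rw [← hq] at hsplit'
  have hpos : 0 < (candidatePath hn lab y (p + 1) : ℕ) := by
    rw [candidatePath_succ hn lab y p.isLt]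
    exact candidate_pos lab _ _
  obtain ⟨j, hj⟩ := (hsplit y).exists_edge_mem hM hpos (hmentions y p hp).1 (hmentions y p hp).2
    hsplit'
  rw [← List.count_pos_iff, hcount] at hj
  simp only [pathVector] at hj
  split_ifs at hj with hedge
  swap
  · exact absurd hj (lt_irrefl 0)
  obtain ⟨t, ht, -, heq⟩ := hedge
  have heq := congrArg Fin.val heq
  rw [candidatePath_succ hn lab y p.isLt] at heq
  rcases ht.lt_or_eq with ht | rfl
  · rw [candidatePath_succ hn lab y' ht] at heq
    obtain ⟨rfl, h⟩ := candidate_inj lab (Fin.isLt _) (Fin.isLt _) heq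
    exact Fin.ext h
  · rw [candidatePath_last] at heq
    have := candidate_add_two_le hn lab p.isLt (y p).isLt
    simp only [Fin.eta] at heq
    omega

theorem blockLength_le_exp {w : ℕ} {L : ℝ} (hw : 0 < w) (hL : 8 ≤ L)
    (hlog : 256 * Real.log L ≤ L) (hlog₁ : 1 ≤ Real.log L)
    (hwL : (w : ℝ) ^ 2 * Real.log L ≤ L) :
    (blockLength ((4 * w + 3) * w) (4 * w + 3) w : ℝ) ≤ 2 * Real.exp (L / 8) := by
  have hw₁ : (1 : ℝ) ≤ w := by exact_mod_cast hw
  have hL₀ : 0 < L := by linarith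
  rw [blockLength_self hw]
  push_cast
  have hbase : (4 * (w : ℝ) + 3) * w ≤ L ^ 2 := by nlinarith
  have hexp : w * Real.log L ≤ L / 16 := by
    refine abs_le_of_sq_le_sq' ?_ (by linarith) |>.2
    nlinarith
  calc 2 * ((4 * (w : ℝ) + 3) * w) ^ w ≤ 2 * (L ^ 2) ^ w := by gcongr
    _ = 2 * Real.exp (2 * (w * Real.log L)) := by
      rw [← pow_mul, ← mul_assoc, mul_comm _ (Real.log L), Real.exp_mul, Real.exp_log hL₀,
        ← Real.rpow_natCast]
      push_cast
      rfl
    _ ≤ 2 * Real.exp (L / 8) := by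
      gcongr
      linarith

theorem two_mul_add_two_le {n K : ℕ} (hL : 8 ≤ Real.log n)
    (hK : (K : ℝ) ≤ 2 * Real.exp (Real.log n / 8)) : 2 * (⌈√(n : ℝ)⌉₊ * K) + 2 ≤ n := by
  have hn : (0 : ℝ) < n := by
    by_contra! h
    rw [le_antisymm h n.cast_nonneg, Real.log_zero] at hL
    linarith
  set m := Real.exp (Real.log n / 8) with hm
  have hm₂ : 2 ≤ m := by
    have := Real.add_one_le_exp (Real.log n / 8)
    linarith
  have hm₈ : (n : ℝ) = m ^ 8 := by
    rw [hm, ← Real.exp_nat_mul]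
    push_cast
    rw [mul_div_cancel₀ _ (by norm_num), Real.exp_log hn]
  have hsqrt : √(n : ℝ) = m ^ 4 := by
    rw [hm₈, show m ^ 8 = (m ^ 4) ^ 2 by ring, Real.sqrt_sq (by positivity)]
  have hg : (⌈√(n : ℝ)⌉₊ : ℝ) ≤ m ^ 4 + 1 := by
    rw [← hsqrt]
    exact (Nat.ceil_lt_add_one (Real.sqrt_nonneg _)).le
  have hgK : (⌈√(n : ℝ)⌉₊ : ℝ) * K ≤ (m ^ 4 + 1) * (2 * m) := by gcongr
  have h₃ : (8 : ℝ) ≤ m ^ 3 := by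
    calc (8 : ℝ) = 2 ^ 3 := by norm_num
      _ ≤ m ^ 3 := by gcongr
  have h₅ : 16 * m ≤ m ^ 5 := by
    calc 16 * m = 2 ^ 4 * m := by norm_num
      _ ≤ m ^ 4 * m := by gcongr
      _ = m ^ 5 := by ring
  have h₈ : 8 * m ^ 5 ≤ m ^ 8 := by
    calc 8 * m ^ 5 ≤ m ^ 3 * m ^ 5 := by gcongr
      _ = m ^ 8 := by ring
  have : 2 * ((⌈√(n : ℝ)⌉₊ : ℝ) * K) + 2 ≤ n := by
    have hexpand : (m ^ 4 + 1) * (2 * m) = 2 * m ^ 5 + 2 * m := by ring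
    linarith
  exact_mod_cast this

theorem eventually_log_bounds :
    ∀ᶠ n : ℕ in Filter.atTop, 8 ≤ Real.log n ∧ 1 ≤ Real.log (Real.log n) ∧
      256 * Real.log (Real.log n) ≤ Real.log n := by
  have hlog : Filter.Tendsto (fun n : ℕ => Real.log n) Filter.atTop Filter.atTop :=
    Real.tendsto_log_atTop.comp tendsto_natCast_atTop_atTop
  have hlittle := Real.isLittleO_log_id_atTop.bound (show (0 : ℝ) < 1 / 256 by norm_num)
  filter_upwards [hlog.eventually_ge_atTop 8,
    (Real.tendsto_log_atTop.comp hlog).eventually_ge_atTop 1, hlog.eventually hlittle]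
    with n h₁ h₂ h₃
  rw [Function.comp_apply] at h₂
  refine ⟨h₁, h₂, ?_⟩
  rw [id, Real.norm_of_nonneg (zero_le_one.trans h₂), Real.norm_of_nonneg (by linarith)] at h₃
  linarith

theorem rpow_le_card {n : ℕ} (hL : 8 ≤ Real.log n) (hlog₁ : 1 ≤ Real.log (Real.log n))
    (hlog : 256 * Real.log (Real.log n) ≤ Real.log n) {Q : Type*} [Fintype Q]
    {M : NFA (Alph n) Q} (hM : ParikhImage M = UniversalOCA n) :
    (n : ℝ) ^ (1 / 2 * √(Real.log n / Real.log (Real.log n))) ≤ Fintype.card Q := by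
  set S := √(Real.log n / Real.log (Real.log n)) with hS
  have hquot : 1 ≤ Real.log n / Real.log (Real.log n) := by
    rw [le_div_iff₀ (by linarith)]
    linarith
  have hw : 0 < ⌊S⌋₊ := Nat.floor_pos.2 (Real.one_le_sqrt.2 hquot)
  have hn : 0 < n := by
    rcases Nat.eq_zero_or_pos n with rfl | h
    · simp at hL
      linarith
    · exact h
  have hn₁ : (1 : ℝ) ≤ √(n : ℝ) := Real.one_le_sqrt.2 (by exact_mod_cast hn)
  have hwL : (⌊S⌋₊ : ℝ) ^ 2 * Real.log (Real.log n) ≤ Real.log n := by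
    rw [← le_div_iff₀ (by linarith), ← Real.sq_sqrt (zero_le_one.trans hquot)]
    have := Nat.floor_le (Real.sqrt_nonneg (Real.log n / Real.log (Real.log n)))
    gcongr
  have hcard := pow_succ_le_card hw (Nat.ceil_pos.2 (zero_lt_one.trans_le hn₁))
    (two_mul_add_two_le hL (blockLength_le_exp hw hL hlog hlog₁ hwL)) hM
  calc (n : ℝ) ^ (1 / 2 * S) = √(n : ℝ) ^ S := by
        rw [Real.rpow_mul n.cast_nonneg, Real.sqrt_eq_rpow]
    _ ≤ √(n : ℝ) ^ ((⌊S⌋₊ + 1 : ℕ) : ℝ) := by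
      refine Real.rpow_le_rpow_of_exponent_le hn₁ ?_
      push_cast
      exact (Nat.lt_floor_add_one S).le
    _ = √(n : ℝ) ^ (⌊S⌋₊ + 1) := Real.rpow_natCast _ _
    _ ≤ (⌈√(n : ℝ)⌉₊ : ℝ) ^ (⌊S⌋₊ + 1) := by
      gcongr
      exact Nat.le_ceil _
    _ ≤ Fintype.card Q := by exact_mod_cast hcard

/-- Every NFA whose language has Parikh image equal to the universal
one-counter set Uₙ has at least n^{Ω(√(log n / log log n))} states. -/
theorem nfa_states_lower : ∃ (c : ℝ) (N : ℕ), 0 < c ∧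
    ∀ n : ℕ, Even n → N ≤ n →
    ∀ (Q : Type) [Fintype Q] (A : NFA (Alph n) Q),
      ParikhImage A = UniversalOCA n →
      (n : ℝ) ^ (c * Real.sqrt (Real.log (n : ℝ) / Real.log (Real.log (n : ℝ))))
        ≤ (Fintype.card Q : ℝ) := by
  obtain ⟨N, hN⟩ := Filter.eventually_atTop.1 eventually_log_bounds
  exact ⟨1 / 2, N, by norm_num, fun n _ hn Q _ A hA =>
    rpow_le_card (hN n hn).1 (hN n hn).2.1 (hN n hn).2.2 hA⟩
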